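/- Let d ≥ 7 and set d₀ = √(6(d-1)(d-6)), c₁ = (4/25)((3d-8)d₀ + 8d² - 56d + 48), c₂ = (4/5)d₀, c₃ = (1/15)(3d - 18 + d₀). Then the function u(t,x) = (1/t²)·U(|x|/t) with U(ρ) = (c₁ - c₂ρ²)/(c₃ + ρ²)² satisfies the PDE ∂²_t u - Δu = u² on the region {(t,x) ∈ ℝ⁺ × ℝ^d}. -/

import Mathlib

/-- Second derivative of a quadratic divided by the square of a quadratic. -/
lemma iteratedDeriv_two_quadratic_div_sq (a b c p q r s : ℝ) (h : p + q * s + r * s ^ 2 ≠ 0) :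
    iteratedDeriv 2 (fun s : ℝ => (a + b * s + c * s ^ 2) / (p + q * s + r * s ^ 2) ^ 2) s
      = 2 * c / (p + q * s + r * s ^ 2) ^ 2
        - 4 * (b + 2 * c * s) * (q + 2 * r * s) / (p + q * s + r * s ^ 2) ^ 3
        - 4 * r * (a + b * s + c * s ^ 2) / (p + q * s + r * s ^ 2) ^ 3
        + 6 * (a + b * s + c * s ^ 2) * (q + 2 * r * s) ^ 2 / (p + q * s + r * s ^ 2) ^ 4 := by
  have hquad : ∀ a b c y : ℝ,
      HasDerivAt (fun s : ℝ => a + b * s + c * s ^ 2) (b + 2 * c * y) y := by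
    intro a b c y
    refine ((((hasDerivAt_id y).const_mul b).const_add a).add
      (((hasDerivAt_id y).pow 2).const_mul c)).congr_deriv ?_
    simp
    ring
  have hfirst : ∀ y : ℝ, p + q * y + r * y ^ 2 ≠ 0 →
      HasDerivAt (fun s : ℝ => (a + b * s + c * s ^ 2) / (p + q * s + r * s ^ 2) ^ 2)
        ((b + 2 * c * y) / (p + q * y + r * y ^ 2) ^ 2
          - 2 * (a + b * y + c * y ^ 2) * (q + 2 * r * y) / (p + q * y + r * y ^ 2) ^ 3) y := by
    intro y hy
    refine ((hquad a b c y).div ((hquad p q r y).pow 2) (pow_ne_zero 2 hy)).congr_deriv ?_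
    simp only [Pi.pow_apply]
    generalize p + q * y + r * y ^ 2 = D at hy ⊢
    field_simp
    push_cast
    ring
  have hlin : HasDerivAt (fun y : ℝ => b + 2 * c * y) (2 * c) s := by
    simpa using ((hasDerivAt_id s).const_mul (2 * c)).const_add b
  have hlin' : HasDerivAt (fun y : ℝ => q + 2 * r * y) (2 * r) s := by
    simpa using ((hasDerivAt_id s).const_mul (2 * r)).const_add q
  have hsecond := (hlin.div ((hquad p q r s).pow 2) (pow_ne_zero 2 h)).sub
    ((((hquad a b c s).const_mul 2).mul hlin').div ((hquad p q r s).pow 3) (pow_ne_zero 3 h))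
  have hev : deriv (fun s : ℝ => (a + b * s + c * s ^ 2) / (p + q * s + r * s ^ 2) ^ 2)
      =ᶠ[nhds s] fun y => (b + 2 * c * y) / (p + q * y + r * y ^ 2) ^ 2
          - 2 * (a + b * y + c * y ^ 2) * (q + 2 * r * y) / (p + q * y + r * y ^ 2) ^ 3 := by
    filter_upwards [(hquad p q r s).continuousAt.eventually_ne h] with y hy
    exact (hfirst y hy).deriv
  rw [iteratedDeriv_succ, iteratedDeriv_one, hev.deriv_eq]
  refine Eq.trans hsecond.deriv ?_
  simp only [Pi.pow_apply, Pi.mul_apply]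
  generalize p + q * s + r * s ^ 2 = D at h ⊢
  field_simp
  push_cast
  ring

/-- The square of the norm along a coordinate line. -/
lemma EuclideanSpace.norm_sq_add_smul_single {d : ℕ} (x : EuclideanSpace ℝ (Fin d)) (i : Fin d)
    (s : ℝ) :
    ‖x + s • EuclideanSpace.single i (1 : ℝ)‖ ^ 2 = ‖x‖ ^ 2 + 2 * x i * s + s ^ 2 := by
  rw [norm_add_sq_real, inner_smul_right, EuclideanSpace.inner_single_right, norm_smul]
  simp
  ring


/-- The explicit self-similar solution `u(t,x) = t⁻² U(|x|/t)` with
`U(ρ) = (c₁ - c₂ρ²)/(c₃ + ρ²)²` solves the focusing quadratic wave equation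
`∂²_t u - Δu = u²` on `ℝ⁺ × ℝ^d` for every `d ≥ 7`. -/
theorem self_similar_solution_quadratic_wave
    (d : ℕ) (hd : 7 ≤ d)
    (d0 c1 c2 c3 : ℝ)
    (hd0 : d0 = Real.sqrt (6 * ((d : ℝ) - 1) * ((d : ℝ) - 6)))
    (hc1 : c1 = (4 / 25) * ((3 * (d : ℝ) - 8) * d0 + 8 * (d : ℝ) ^ 2 - 56 * (d : ℝ) + 48))
    (hc2 : c2 = (4 / 5) * d0)
    (hc3 : c3 = (1 / 15) * (3 * (d : ℝ) - 18 + d0))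
    (U : ℝ → ℝ) (hU : ∀ ρ : ℝ, U ρ = (c1 - c2 * ρ ^ 2) / (c3 + ρ ^ 2) ^ 2)
    (u : ℝ → EuclideanSpace ℝ (Fin d) → ℝ)
    (hu : ∀ t x, u t x = (1 / t ^ 2) * U (‖x‖ / t)) :
    ∀ t : ℝ, 0 < t → ∀ x : EuclideanSpace ℝ (Fin d),
      iteratedDeriv 2 (fun s => u s x) t
        - ∑ i : Fin d,
            iteratedDeriv 2 (fun s : ℝ => u t (x + s • EuclideanSpace.single i 1)) 0
      = (u t x) ^ 2 := by
  have hd' : (7 : ℝ) ≤ d := by exact_mod_cast hd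
  have hd0nn : 0 ≤ d0 := hd0 ▸ Real.sqrt_nonneg _
  have hd0sq : d0 ^ 2 = 6 * ((d : ℝ) - 1) * ((d : ℝ) - 6) := by
    rw [hd0, Real.sq_sqrt]
    exact mul_nonneg (by linarith) (by linarith)
  have hc3pos : 0 < c3 := by rw [hc3]; linarith
  have hu' : ∀ t : ℝ, 0 < t → ∀ x : EuclideanSpace ℝ (Fin d),
      u t x = (c1 * t ^ 2 - c2 * ‖x‖ ^ 2) / (c3 * t ^ 2 + ‖x‖ ^ 2) ^ 2 := by
    intro t ht x
    have h : c3 * t ^ 2 + ‖x‖ ^ 2 ≠ 0 := by positivity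
    have h' : c3 + (‖x‖ / t) ^ 2 ≠ 0 := by positivity
    rw [hu, hU]
    field_simp
  intro t ht x
  have hD : 0 < c3 * t ^ 2 + ‖x‖ ^ 2 := by positivity
  have htime : (fun s => u s x) =ᶠ[nhds t] fun s =>
      (-c2 * ‖x‖ ^ 2 + 0 * s + c1 * s ^ 2) / (‖x‖ ^ 2 + 0 * s + c3 * s ^ 2) ^ 2 := by
    filter_upwards [lt_mem_nhds ht] with s hs
    rw [hu' s hs]
    congr 1 <;> ring
  have hspace : ∀ i : Fin d, (fun s : ℝ => u t (x + s • EuclideanSpace.single i 1)) = fun s =>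
      ((c1 * t ^ 2 - c2 * ‖x‖ ^ 2) + (-2 * c2 * x i) * s + (-c2) * s ^ 2) /
        ((c3 * t ^ 2 + ‖x‖ ^ 2) + (2 * x i) * s + 1 * s ^ 2) ^ 2 := by
    intro i
    funext s
    rw [hu' t ht, EuclideanSpace.norm_sq_add_smul_single]
    congr 1 <;> ring
  have hspace2 : ∀ i : Fin d,
      iteratedDeriv 2 (fun s : ℝ => u t (x + s • EuclideanSpace.single i 1)) 0
        = (-2 * c2 / (c3 * t ^ 2 + ‖x‖ ^ 2) ^ 2
            - 4 * (c1 * t ^ 2 - c2 * ‖x‖ ^ 2) / (c3 * t ^ 2 + ‖x‖ ^ 2) ^ 3)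
          + (16 * c2 / (c3 * t ^ 2 + ‖x‖ ^ 2) ^ 3
            + 24 * (c1 * t ^ 2 - c2 * ‖x‖ ^ 2) / (c3 * t ^ 2 + ‖x‖ ^ 2) ^ 4) * x i ^ 2 := by
    intro i
    rw [hspace i, iteratedDeriv_two_quadratic_div_sq _ _ _ _ _ _ _ (by simpa using hD.ne')]
    ring
  rw [Finset.sum_congr rfl fun i _ => hspace2 i, Finset.sum_add_distrib, Finset.sum_const,
    ← Finset.mul_sum, ← EuclideanSpace.real_norm_sq_eq, htime.iteratedDeriv_eq,
    iteratedDeriv_two_quadratic_div_sq _ _ _ _ _ _ _ (by rw [zero_mul]; positivity),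
    hu' t ht]
  have hden : ‖x‖ ^ 2 + 0 * t + c3 * t ^ 2 = c3 * t ^ 2 + ‖x‖ ^ 2 := by ring
  rw [hden, Finset.card_univ, Fintype.card_fin, nsmul_eq_mul]
  generalize ‖x‖ = r at *
  have hne := hD.ne'
  field_simp
  rw [hc1, hc2, hc3]
  linear_combination (-32 / 75 * r ^ 4
    + (128 / 125 - 16 / 225 * d0 - 64 / 375 * d) * t ^ 2 * r ^ 2
    + (-128 / 625 - 64 / 1875 * d0 - 512 / 1875 * d + 112 / 5625 * d * d0 + 32 / 625 * d ^ 2)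
      * t ^ 4) * hd0sq
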